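/- Let f : ℝⁿ → ℝ be subdifferentiable with L-Lipschitz subdifferential. Let x ∈ ℝⁿ, d ∈ ℝⁿ with d ≠ 0, g ∈ ∂f(x), 0 < γ < 1, η > 0, and α > 0. If the Armijo-type condition is violated at step 2α, i.e., f(x + 2α d) − f(x) > 2γα gᵀd + η, then α ≥ ((γ − 1)/L) · (gᵀd / ‖d‖²). -/

import Mathlib

open Filter Finset RealInnerProductSpace

/-- `g` is a subgradient of `f` at `x`: `f y ≥ f x + ⟪g, y - x⟫` for all `y`. -/
def IsSubgradientAt {n : ℕ} (f : EuclideanSpace ℝ (Fin n) → ℝ)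
    (g x : EuclideanSpace ℝ (Fin n)) : Prop :=
  ∀ y, f y ≥ f x + ⟪g, y - x⟫

/-- `f` is subdifferentiable: its subdifferential is nonempty at every point. -/
def Subdifferentiable {n : ℕ} (f : EuclideanSpace ℝ (Fin n) → ℝ) : Prop :=
  ∀ x, ∃ g, IsSubgradientAt f g x

/-- One-sided growth bound for `f` along the arithmetic progression `x + k • v`. -/
lemma IsSubgradientAt.le_add_nsmul {n : ℕ} {f : EuclideanSpace ℝ (Fin n) → ℝ} {L : ℝ}
    (hf : Subdifferentiable f)
    (hlip : ∀ x y gx gy, IsSubgradientAt f gx x → IsSubgradientAt f gy y →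
      ‖gx - gy‖ ≤ L * ‖x - y‖)
    {x g : EuclideanSpace ℝ (Fin n)} (hg : IsSubgradientAt f g x)
    (v : EuclideanSpace ℝ (Fin n)) (k : ℕ) :
    f (x + (k : ℝ) • v) ≤ f x + k * ⟪g, v⟫ + L * (k * (k + 1) / 2) * ‖v‖ ^ 2 := by
  induction k with
  | zero => simp
  | succ k ih =>
    obtain ⟨g', hg'⟩ := hf (x + ((k + 1 : ℕ) : ℝ) • v)
    have hstep := hg' (x + (k : ℝ) • v)
    have hdiff : x + (k : ℝ) • v - (x + ((k + 1 : ℕ) : ℝ) • v) = -v := by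
      push_cast
      module
    rw [hdiff, inner_neg_right] at hstep
    have hnorm := hlip _ _ _ _ hg' hg
    rw [add_sub_cancel_left, norm_smul, Real.norm_natCast] at hnorm
    have hinner : ⟪g', v⟫ - ⟪g, v⟫ ≤ L * (((k + 1 : ℕ) : ℝ) * ‖v‖) * ‖v‖ := by
      rw [← inner_sub_left]
      exact (real_inner_le_norm _ _).trans (by gcongr)
    push_cast at *
    linarith

/-- The descent lemma for functions with Lipschitz subdifferential. -/
lemma IsSubgradientAt.le_add_quadratic {n : ℕ} {f : EuclideanSpace ℝ (Fin n) → ℝ} {L : ℝ}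
    (hf : Subdifferentiable f)
    (hlip : ∀ x y gx gy, IsSubgradientAt f gx x → IsSubgradientAt f gy y →
      ‖gx - gy‖ ≤ L * ‖x - y‖)
    {x g : EuclideanSpace ℝ (Fin n)} (hg : IsSubgradientAt f g x)
    (w : EuclideanSpace ℝ (Fin n)) :
    f (x + w) ≤ f x + ⟪g, w⟫ + L / 2 * ‖w‖ ^ 2 := by
  have hlim : Tendsto (fun N : ℕ => f x + ⟪g, w⟫ + L / 2 * (1 + 1 / ((N : ℝ) + 1)) * ‖w‖ ^ 2)
      atTop (nhds (f x + ⟪g, w⟫ + L / 2 * (1 + 0) * ‖w‖ ^ 2)) :=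
    (((tendsto_one_div_add_atTop_nhds_zero_nat.const_add 1).const_mul _).mul_const _).const_add _
  rw [add_zero, mul_one] at hlim
  refine ge_of_tendsto' hlim fun N => ?_
  have hN : (N : ℝ) + 1 ≠ 0 := by positivity
  have h := hg.le_add_nsmul hf hlip (((N : ℝ) + 1)⁻¹ • w) (N + 1)
  push_cast at h
  rw [smul_inv_smul₀ hN, real_inner_smul_right, norm_smul, mul_pow, Real.norm_eq_abs,
    sq_abs] at h
  refine h.trans_eq ?_
  field_simp

/-- if the Armijo-type condition is violated at step `2α`, i.e.
`f(x + 2αd) - f(x) > 2γα⟪g,d⟫ + η`, then `α ≥ ((γ-1)/L) ⟪g,d⟫/‖d‖²`. -/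
theorem spectral_stmt3 {n : ℕ} (f : EuclideanSpace ℝ (Fin n) → ℝ)
    (L : ℝ) (hL : 0 < L)
    (hf : Subdifferentiable f)
    (hlip : ∀ x y gx gy, IsSubgradientAt f gx x → IsSubgradientAt f gy y →
      ‖gx - gy‖ ≤ L * ‖x - y‖)
    (x d g : EuclideanSpace ℝ (Fin n)) (hd : d ≠ 0)
    (hg : IsSubgradientAt f g x)
    (γ η α : ℝ) (hγ0 : 0 < γ) (hγ1 : γ < 1) (hη : 0 < η) (hα : 0 < α)
    (hviol : f (x + (2 * α) • d) - f x > 2 * γ * α * ⟪g, d⟫ + η) :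
    α ≥ (γ - 1) / L * (⟪g, d⟫ / ‖d‖ ^ 2) := by
  have hdesc := hg.le_add_quadratic hf hlip ((2 * α) • d)
  rw [real_inner_smul_right, norm_smul, mul_pow, Real.norm_eq_abs, sq_abs] at hdesc
  have hd2 : 0 < ‖d‖ ^ 2 := by positivity
  have hmain : (γ - 1) * ⟪g, d⟫ ≤ α * (L * ‖d‖ ^ 2) := by
    refine le_of_mul_le_mul_left ?_ (show 0 < 2 * α by positivity)
    linarith
  rw [ge_iff_le, div_mul_div_comm, div_le_iff₀ (by positivity)]
  exact hmain
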